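/- arXiv:0707.0035 — 4 statements merged into one kernel-verified Lean document; each statement's English description precedes it below -/
import Mathlib

section
/- Let R be an algebraic Kähler curvature tensor on ℂⁿ with nonnegative holomorphic bisectional curvature, and suppose e_α, e_β ∈ ℂⁿ satisfy R(e_α,ē_α,e_β,ē_β) = 0. Then for every Z ∈ ℂⁿ one has R(e_α,ē_α,Z,ē_β) = 0 and R(e_β,ē_β,Z,ē_α) = 0. -/
open scoped ComplexConjugate InnerProductSpace

noncomputable section

/-- ℂⁿ with its Hermitian inner product. -/
abbrev Cn (n : ℕ) := EuclideanSpace ℂ (Fin n)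

/-- An algebraic Kähler curvature tensor on ℂⁿ: `R X Y Z W` stands for `R(X, Ȳ, Z, W̄)`.
It is ℂ-linear in the 1st and 3rd arguments, conjugate ℂ-linear in the 2nd and 4th, and
satisfies the Kähler symmetries. -/
structure IsKahlerCurv (n : ℕ) (R : Cn n → Cn n → Cn n → Cn n → ℂ) : Prop where
  map_add₁ : ∀ X X' Y Z W, R (X + X') Y Z W = R X Y Z W + R X' Y Z W
  map_smul₁ : ∀ (c : ℂ) X Y Z W, R (c • X) Y Z W = c * R X Y Z W
  map_add₂ : ∀ X Y Y' Z W, R X (Y + Y') Z W = R X Y Z W + R X Y' Z W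
  map_smul₂ : ∀ (c : ℂ) X Y Z W, R X (c • Y) Z W = conj c * R X Y Z W
  map_add₃ : ∀ X Y Z Z' W, R X Y (Z + Z') W = R X Y Z W + R X Y Z' W
  map_smul₃ : ∀ (c : ℂ) X Y Z W, R X Y (c • Z) W = c * R X Y Z W
  map_add₄ : ∀ X Y Z W W', R X Y Z (W + W') = R X Y Z W + R X Y Z W'
  map_smul₄ : ∀ (c : ℂ) X Y Z W, R X Y Z (c • W) = conj c * R X Y Z W
  symm₁₃ : ∀ X Y Z W, R X Y Z W = R Z Y X W
  symm₂₄ : ∀ X Y Z W, R X Y Z W = R X W Z Y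
  conj_symm : ∀ X Y Z W, conj (R X Y Z W) = R Y X W Z

/-- For fixed `A` the Hermitian form `R(A, Ā, ·, ·)` is positive semidefinite, so its null vectors
lie in its kernel. -/
theorem IsKahlerCurv.eq_zero_of_self_eq_zero {n : ℕ} {R : Cn n → Cn n → Cn n → Cn n → ℂ}
    (hR : IsKahlerCurv n R) {A B : Cn n} (hA : ∀ Y : Cn n, 0 ≤ (R A A Y Y).re)
    (hzero : R A A B B = 0) (Z : Cn n) : R A A Z B = 0 := by
  have hconj : R A A B Z = conj (R A A Z B) := (hR.conj_symm A A Z B).symm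
  have hq := hA Z
  have key : ∀ t : ℝ, 0 ≤ Complex.normSq (R A A Z B) * (t ^ 2 * (R A A Z Z).re - 2 * t) := by
    intro t
    have h := hA (B + (-(t : ℂ) * conj (R A A Z B)) • Z)
    simp only [hR.map_add₃, hR.map_add₄, hR.map_smul₃, hR.map_smul₄, hzero, hconj] at h
    simp only [map_mul, map_neg, Complex.conj_conj, Complex.conj_ofReal, Complex.add_re,
      Complex.mul_re, Complex.mul_im, Complex.neg_re, Complex.neg_im, Complex.conj_re,
      Complex.conj_im, Complex.ofReal_re, Complex.ofReal_im, Complex.zero_re] at h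
    rw [Complex.normSq_apply]
    linarith
  set q := (R A A Z Z).re
  have ht := key (1 / (1 + q))
  have hneg : (1 / (1 + q)) ^ 2 * q - 2 * (1 / (1 + q)) < 0 := by
    have : (1 / (1 + q)) ^ 2 * q - 2 * (1 / (1 + q)) = -(2 + q) / (1 + q) ^ 2 := by
      field_simp
      ring
    rw [this]
    exact div_neg_of_neg_of_pos (by linarith) (by positivity)
  refine Complex.normSq_eq_zero.mp (le_antisymm ?_ (Complex.normSq_nonneg _))
  by_contra! hpos
  exact absurd ht (not_le.mpr (mul_neg_of_pos_of_neg hpos hneg))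

/-- If `R` has nonnegative holomorphic bisectional curvature and
`R(e_α,ē_α,e_β,ē_β) = 0`, then `R(e_α,ē_α,Z,ē_β) = 0` and `R(e_β,ē_β,Z,ē_α) = 0`
for every `Z`. -/
theorem stmt1 {n : ℕ} (R : Cn n → Cn n → Cn n → Cn n → ℂ)
    (hR : IsKahlerCurv n R)
    (hnonneg : ∀ X Y : Cn n, 0 ≤ (R X X Y Y).re)
    (eα eβ : Cn n) (hzero : R eα eα eβ eβ = 0) :
    ∀ Z : Cn n, R eα eα Z eβ = 0 ∧ R eβ eβ Z eα = 0 := by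
  have hzero' : R eβ eβ eα eα = 0 := by
    rw [hR.symm₁₃, hR.symm₂₄, hzero]
  exact fun Z => ⟨hR.eq_zero_of_self_eq_zero (hnonneg eα) hzero Z,
    hR.eq_zero_of_self_eq_zero (hnonneg eβ) hzero' Z⟩
end
end

section
/- Let R be an algebraic Kähler curvature tensor on ℂⁿ with nonnegative holomorphic bisectional curvature, and suppose e_α, e_β ∈ ℂⁿ satisfy R(e_α,ē_α,e_β,ē_β) = 0. Then for all Z, W ∈ ℂⁿ the second-variation inequality holds: R(Z,Z̄,e_β,ē_β) + R(e_α,ē_α,W,W̄) + 2·Re R(Z,ē_α,W,ē_β) + 2·Re R(Z,ē_α,e_β,W̄) ≥ 0 (here the first two summands are real by the symmetries of R, and the inequality is between real numbers). -/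
open scoped ComplexConjugate InnerProductSpace

noncomputable section

/-- An even quartic that is nonnegative and vanishes at the origin has a nonnegative
quadratic coefficient. -/
lemma quadratic_coeff_nonneg_of_even_quartic_nonneg {b d : ℝ}
    (h : ∀ t : ℝ, 0 ≤ b * t ^ 2 + d * t ^ 4) : 0 ≤ b := by
  by_contra! hb
  have hd : 0 < 2 * (|d| + 1) := by positivity
  set s : ℝ := -b / (2 * (|d| + 1))
  have hs0 : 0 < s := div_pos (neg_pos.mpr hb) hd
  have hsd : s * (2 * (|d| + 1)) = -b := div_mul_cancel₀ _ hd.ne'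
  have ht := h (√s)
  have hsq : √s ^ 2 = s := Real.sq_sqrt hs0.le
  have h4 : √s ^ 4 = s ^ 2 := by rw [show √s ^ 4 = (√s ^ 2) ^ 2 by ring, hsq]
  rw [hsq, h4] at ht
  have hfac : 0 ≤ b + d * s := nonneg_of_mul_nonneg_right (by linarith) hs0
  nlinarith [mul_le_mul_of_nonneg_right (le_abs_self d) hs0.le]

/-- The part of the bisectional curvature along `X + t Z`, `Y + t W` that is even in `t`. -/
lemma IsKahlerCurv.re_add_re_variation {n : ℕ} {R : Cn n → Cn n → Cn n → Cn n → ℂ}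
    (hR : IsKahlerCurv n R) (X Y Z W : Cn n) (t : ℝ) :
    (R (X + (t : ℂ) • Z) (X + (t : ℂ) • Z) (Y + (t : ℂ) • W) (Y + (t : ℂ) • W)).re +
      (R (X + ((-t : ℝ) : ℂ) • Z) (X + ((-t : ℝ) : ℂ) • Z)
        (Y + ((-t : ℝ) : ℂ) • W) (Y + ((-t : ℝ) : ℂ) • W)).re =
    2 * ((R X X Y Y).re + ((R Z Z Y Y).re + (R X X W W).re +
      2 * (R Z X W Y).re + 2 * (R Z X Y W).re) * t ^ 2 + (R Z Z W W).re * t ^ 4) := by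
  have h1 : (R X Z Y W).re = (R Z X W Y).re := by
    rw [← hR.conj_symm, Complex.conj_re]
  have h2 : (R X Z W Y).re = (R Z X Y W).re := by
    rw [← hR.conj_symm, Complex.conj_re]
  simp only [hR.map_add₁, hR.map_add₂, hR.map_add₃, hR.map_add₄, hR.map_smul₁, hR.map_smul₂,
    hR.map_smul₃, hR.map_smul₄, Complex.conj_ofReal, Complex.add_re, Complex.re_ofReal_mul, h1, h2]
  ring

/-- Second-variation inequality at a zero of the holomorphic
bisectional curvature. -/
theorem stmt2 {n : ℕ} (R : Cn n → Cn n → Cn n → Cn n → ℂ)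
    (hR : IsKahlerCurv n R)
    (hnonneg : ∀ X Y : Cn n, 0 ≤ (R X X Y Y).re)
    (eα eβ : Cn n) (hzero : R eα eα eβ eβ = 0) :
    ∀ Z W : Cn n,
      0 ≤ (R Z Z eβ eβ).re + (R eα eα W W).re +
        2 * (R Z eα W eβ).re + 2 * (R Z eα eβ W).re := by
  intro Z W
  apply quadratic_coeff_nonneg_of_even_quartic_nonneg (d := (R Z Z W W).re)
  intro t
  have h := hR.re_add_re_variation eα eβ Z W t
  rw [hzero, Complex.zero_re] at h
  linarith [hnonneg (eα + (t : ℂ) • Z) (eβ + (t : ℂ) • W),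
    hnonneg (eα + ((-t : ℝ) : ℂ) • Z) (eβ + ((-t : ℝ) : ℂ) • W)]
end
end

section
/- Let R be an algebraic Kähler curvature tensor on ℂⁿ and let e_α, e_β ∈ ℂⁿ satisfy: R(e_α,ē_α,e_β,ē_β) = 0; R(e_α,ē_β,Z,W̄) = 0 for all Z, W ∈ ℂⁿ; and R(e_α,ē_α,Z,ē_β) = 0 and R(e_β,ē_β,Z,ē_α) = 0 for all Z ∈ ℂⁿ. For θ ∈ ℝ define ẽ_α = (sin θ)·e_α − (cos θ)·e_β and ẽ_β = (cos θ)·e_α + (sin θ)·e_β. Then R(ẽ_α, conj ẽ_α, ẽ_β, conj ẽ_β) = cos²θ·sin²θ·( R(e_α,ē_α,e_α,ē_α) + R(e_β,ē_β,e_β,ē_β) ). -/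
open scoped ComplexConjugate InnerProductSpace

noncomputable section

/-- Rotation computation: under the vanishing conditions, the holomorphic
bisectional curvature of the rotated pair equals
`cos²θ sin²θ (R(e_α,ē_α,e_α,ē_α) + R(e_β,ē_β,e_β,ē_β))`. -/
theorem stmt10 {n : ℕ} (R : Cn n → Cn n → Cn n → Cn n → ℂ)
    (hR : IsKahlerCurv n R)
    (eα eβ : Cn n)
    (hzero : R eα eα eβ eβ = 0)
    (h1 : ∀ Z W : Cn n, R eα eβ Z W = 0)
    (h2 : ∀ Z : Cn n, R eα eα Z eβ = 0)
    (h3 : ∀ Z : Cn n, R eβ eβ Z eα = 0)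
    (θ : ℝ) :
    R ((Real.sin θ : ℂ) • eα - (Real.cos θ : ℂ) • eβ)
      ((Real.sin θ : ℂ) • eα - (Real.cos θ : ℂ) • eβ)
      ((Real.cos θ : ℂ) • eα + (Real.sin θ : ℂ) • eβ)
      ((Real.cos θ : ℂ) • eα + (Real.sin θ : ℂ) • eβ) =
    ((Real.cos θ ^ 2 * Real.sin θ ^ 2 : ℝ) : ℂ) *
      (R eα eα eα eα + R eβ eβ eβ eβ) := by
  have h1' : ∀ Z W : Cn n, R eβ eα Z W = 0 := fun Z W => by
    rw [← hR.conj_symm, h1, map_zero]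
  have hα : R eα eα eβ eα = 0 := by rw [hR.symm₁₃, h1']
  have hβ : R eβ eβ eα eβ = 0 := by rw [hR.symm₁₃, h1]
  have hsub : (Real.sin θ : ℂ) • eα - (Real.cos θ : ℂ) • eβ =
      (Real.sin θ : ℂ) • eα + (-(Real.cos θ : ℂ)) • eβ := by
    rw [neg_smul, sub_eq_add_neg]
  rw [hsub]
  simp only [hR.map_add₁, hR.map_add₂, hR.map_add₃, hR.map_add₄, hR.map_smul₁, hR.map_smul₂,
    hR.map_smul₃, hR.map_smul₄, h1, h1', h2, h3, hα, hβ, map_neg,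
    Complex.conj_ofReal]
  push_cast
  ring
end
end

section
/- Let R be an algebraic Kähler curvature tensor on ℂⁿ with positive holomorphic sectional curvature, and let e_α, e_β ∈ ℂⁿ be nonzero vectors satisfying: R(e_α,ē_α,e_β,ē_β) = 0; R(e_α,ē_β,Z,W̄) = 0 for all Z, W ∈ ℂⁿ; and R(e_α,ē_α,Z,ē_β) = 0 and R(e_β,ē_β,Z,ē_α) = 0 for all Z ∈ ℂⁿ. Then for every θ ∈ ℝ with sin θ · cos θ ≠ 0, the rotated pair ẽ_α = (sin θ)·e_α − (cos θ)·e_β, ẽ_β = (cos θ)·e_α + (sin θ)·e_β satisfies R(ẽ_α, conj ẽ_α, ẽ_β, conj ẽ_β) > 0; in particular the holomorphic bisectional curvature of R does not vanish at the pair (ẽ_α, ẽ_β). -/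
open scoped ComplexConjugate InnerProductSpace

noncomputable section

/-- If `R(a, b̄, ·, ·) = 0`, the bisectional curvature of the pair `(s a - c b, c a + s b)` with
real `s`, `c` is `(s c)²` times the sum of the holomorphic sectional curvatures at `a` and `b`. -/
theorem IsKahlerCurv.bisectional_rotation {n : ℕ} {R : Cn n → Cn n → Cn n → Cn n → ℂ}
    (hR : IsKahlerCurv n R) {a b : Cn n} (hab : ∀ Z W, R a b Z W = 0) (s c : ℝ) :
    R ((s : ℂ) • a - (c : ℂ) • b) ((s : ℂ) • a - (c : ℂ) • b)
        ((c : ℂ) • a + (s : ℂ) • b) ((c : ℂ) • a + (s : ℂ) • b) =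
      (((s * c) ^ 2 : ℝ) : ℂ) * (R a a a a + R b b b b) := by
  have hba : ∀ Z W, R b a Z W = 0 := fun Z W => by
    rw [← hR.conj_symm, hab, map_zero]
  have haab : ∀ Z, R a a Z b = 0 := fun Z => by rw [hR.symm₂₄, hab]
  have hbba : ∀ Z, R b b Z a = 0 := fun Z => by rw [hR.symm₂₄, hba]
  have haaba : R a a b a = 0 := by rw [hR.symm₁₃, hba]
  have hbbab : R b b a b = 0 := by rw [hR.symm₁₃, hab]
  rw [sub_eq_add_neg, ← neg_smul]
  simp only [hR.map_add₁, hR.map_add₂, hR.map_add₃, hR.map_add₄, hR.map_smul₁, hR.map_smul₂,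
    hR.map_smul₃, hR.map_smul₄, hab, hba, haab, hbba, haaba, hbbab, map_neg, Complex.conj_ofReal]
  push_cast
  ring

/-- If `R` has positive holomorphic sectional curvature and the pair
`(e_α, e_β)` satisfies the vanishing conditions, then every rotation with
`sin θ cos θ ≠ 0` has strictly positive holomorphic bisectional curvature; in particular
it does not vanish. -/
theorem stmt11 {n : ℕ} (R : Cn n → Cn n → Cn n → Cn n → ℂ)
    (hR : IsKahlerCurv n R)
    (hsec : ∀ X : Cn n, X ≠ 0 → 0 < (R X X X X).re)
    (eα eβ : Cn n) (hα : eα ≠ 0) (hβ : eβ ≠ 0)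
    (hzero : R eα eα eβ eβ = 0)
    (h1 : ∀ Z W : Cn n, R eα eβ Z W = 0)
    (h2 : ∀ Z : Cn n, R eα eα Z eβ = 0)
    (h3 : ∀ Z : Cn n, R eβ eβ Z eα = 0) :
    ∀ θ : ℝ, Real.sin θ * Real.cos θ ≠ 0 →
      0 < (R ((Real.sin θ : ℂ) • eα - (Real.cos θ : ℂ) • eβ)
            ((Real.sin θ : ℂ) • eα - (Real.cos θ : ℂ) • eβ)
            ((Real.cos θ : ℂ) • eα + (Real.sin θ : ℂ) • eβ)
            ((Real.cos θ : ℂ) • eα + (Real.sin θ : ℂ) • eβ)).re ∧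
      R ((Real.sin θ : ℂ) • eα - (Real.cos θ : ℂ) • eβ)
        ((Real.sin θ : ℂ) • eα - (Real.cos θ : ℂ) • eβ)
        ((Real.cos θ : ℂ) • eα + (Real.sin θ : ℂ) • eβ)
        ((Real.cos θ : ℂ) • eα + (Real.sin θ : ℂ) • eβ) ≠ 0 := by
  intro θ hθ
  have hpos : 0 < (R ((Real.sin θ : ℂ) • eα - (Real.cos θ : ℂ) • eβ)
      ((Real.sin θ : ℂ) • eα - (Real.cos θ : ℂ) • eβ)
      ((Real.cos θ : ℂ) • eα + (Real.sin θ : ℂ) • eβ)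
      ((Real.cos θ : ℂ) • eα + (Real.sin θ : ℂ) • eβ)).re := by
    rw [hR.bisectional_rotation h1, Complex.re_ofReal_mul, Complex.add_re]
    exact mul_pos (by positivity) (add_pos (hsec eα hα) (hsec eβ hβ))
  exact ⟨hpos, fun h => hpos.ne' (by rw [h, Complex.zero_re])⟩
end
end
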